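/- Conditional identification of the β-Jacobi ensemble with a generalized β-Wishart ensemble: fix β ∈ {1, 2} and integers m ≤ n ≤ A, and let λ_X = (λ_{X,1} ≥ ⋯ ≥ λ_{X,n}) denote the eigenvalues of (X^{An})^* X^{An}. Then, conditionally on λ_X, the array τ^l_i := (λ^l_{l+1−i})^{−1} − 1 (1 ≤ i ≤ l ≤ m) of transformed β-Jacobi eigenvalues has the same joint distribution as the non-zero eigenvalue arrays μ^1, …, μ^m of the first m levels of the multilevel generalized β-Wishart ensemble with parameters π_i = λ_{X,i} (1 ≤ i ≤ n) and π̂_j = 0 for all j. -/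

import Mathlib

open MeasureTheory ProbabilityTheory Filter Finset
open scoped ENNReal NNReal BigOperators Classical

noncomputable section

namespace RMT

/-- `Δ(x) = ∏_{i<j<k} (x i - x j)`. -/
def vand (k : ℕ) (x : ℕ → ℝ) : ℝ :=
  ∏ i ∈ range k, ∏ j ∈ range k, if i < j then x i - x j else 1

/-- `Δ^trig(x) = ∏_{i<j<k} (e^{(x i - x j)/2} - e^{(x j - x i)/2})`. -/
def vandTrig (k : ℕ) (x : ℕ → ℝ) : ℝ :=
  ∏ i ∈ range k, ∏ j ∈ range k,
    if i < j then Real.exp ((x i - x j) / 2) - Real.exp ((x j - x i) / 2) else 1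

/-- `Δ(x, y) = ∏_{i<a, j<b} |x i - y j|`. -/
def cross (a b : ℕ) (x y : ℕ → ℝ) : ℝ :=
  ∏ i ∈ range a, ∏ j ∈ range b, |x i - y j|

/-- `|x| = ∑_{i<k} x i`. -/
def asum (k : ℕ) (x : ℕ → ℝ) : ℝ := ∑ i ∈ range k, x i

/-- `x` (of length `a`) interlaces `y` (of length `b`), `a ∈ {b-1, b}`:
`y 0 ≥ x 0 ≥ y 1 ≥ x 1 ≥ ⋯` (0-based). -/
def interlaces (a b : ℕ) (x y : ℕ → ℝ) : Prop :=
  (∀ i, i < a → x i ≤ y i) ∧ ∀ i, i < a → i + 1 < b → y (i + 1) ≤ x i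

/-- `x` is decreasing on its first `k` entries. -/
def decrOn (k : ℕ) (x : ℕ → ℝ) : Prop := ∀ i j, i ≤ j → j < k → x j ≤ x i

/-- strictly decreasing and positive on the first `k` entries -/
def sdecrPos (k : ℕ) (x : ℕ → ℝ) : Prop :=
  (∀ i j, i < j → j < k → x j < x i) ∧ ∀ i, i < k → 0 < x i

/-- Coordinates of a `k`-level triangular array capped at width `n`:
level `l` (0-based) has `min (l+1) n` entries. -/
def coords (k n : ℕ) : Finset (ℕ × ℕ) :=
  (range k ×ˢ range n).filter fun p => p.2 < min (p.1 + 1) n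

/-- The space of `k`-level arrays capped at width `n`. -/
abbrev Arr (k n : ℕ) : Type := { p // p ∈ coords k n } → ℝ

/-- Entry accessor, `0` outside the allowed coordinates. -/
def ent {k n : ℕ} (μ : Arr k n) (l i : ℕ) : ℝ :=
  if h : (l, i) ∈ coords k n then μ ⟨(l, i), h⟩ else 0

/-- Level `l` (1-based) of an `m`-level array; level `0` is the zero sequence. -/
def lev {m n : ℕ} (μ : Arr m n) (l : ℕ) : ℕ → ℝ :=
  fun i => if l = 0 then 0 else ent μ (l - 1) i

/-- Level `l` (1-based) of a Gelfand–Tsetlin pattern with interior `μ`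
(levels `1, …, m-1`) and prescribed top level `lam` (level `m`). -/
def levT {m n : ℕ} (μ : Arr (m - 1) n) (lam : ℕ → ℝ) (l : ℕ) : ℕ → ℝ :=
  fun i => if l = 0 then 0 else if l = m then lam i else ent μ (l - 1) i

/-- The Gelfand–Tsetlin polytope `GT_lam^{(m)}` (interior coordinates). -/
def GTset (m n : ℕ) (lam : ℕ → ℝ) : Set (Arr (m - 1) n) :=
  {μ | ∀ l, 1 ≤ l → l < m →
    interlaces (min l n) (min (l + 1) n) (levT μ lam l) (levT μ lam (l + 1))}

/-- extension of a finite vector by zero -/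
def extF {k : ℕ} (x : Fin k → ℝ) : ℕ → ℝ := fun i => if h : i < k then x ⟨i, h⟩ else 0

/-! ### Multivariate Bessel functions -/

/-- The integral `φ^{n,m}_θ(λ, s)`. -/
def phiB (θ : ℝ) (n m : ℕ) (lam s : ℕ → ℝ) : ℝ :=
  (Real.Gamma θ)⁻¹ ^ (n * (n - 1) / 2 + n * (m - n)) *
    ∫ μ in GTset m n lam,
      (Real.exp (∑ l ∈ Icc 1 m,
          s (l - 1) * (asum (min l n) (levT μ lam l) - asum (min (l - 1) n) (levT μ lam (l - 1)))) *
        ∏ i ∈ range n, levT μ lam n i ^ (θ - 1) / lam i ^ (θ - 1)) *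
      ∏ l ∈ Ico 1 m,
        cross (min l n) (min (l + 1) n) (levT μ lam l) (levT μ lam (l + 1)) ^ (θ - 1) /
          (vand (min l n) (levT μ lam l) ^ (θ - 1) *
            vand (min (l + 1) n) (levT μ lam (l + 1)) ^ (θ - 1))

/-- `Γ(mθ)Γ((m-1)θ)⋯Γ((m-n+1)θ)` -/
def gammaProd (θ : ℝ) (n m : ℕ) : ℝ := ∏ k ∈ Icc (m - n + 1) m, Real.Gamma (k * θ)

/-- The multivariate Bessel function `B^{n,m}_β(λ, s)`, `θ = β/2`. -/
def mvBessel (θ : ℝ) (n m : ℕ) (lam s : ℕ → ℝ) : ℝ :=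
  gammaProd θ n m / Real.Gamma θ ^ n *
    (phiB θ n m lam s / (vand n lam ^ θ * ∏ i ∈ range n, lam i ^ (θ * ((m - n : ℕ) : ℝ))))

/-- The conjugate multivariate Bessel function `B̃^{n,m}_β(λ, s)`. -/
def mvBesselC (θ : ℝ) (n m : ℕ) (lam s : ℕ → ℝ) : ℝ :=
  (Real.Gamma θ)⁻¹ ^ n * (∏ i ∈ range n, lam i ^ (θ - 1)) * mvBessel θ n m lam s

/-! ### Heckman–Opdam hypergeometric functions -/

/-- The integral `Φ^{n,m}_θ(λ, s)`. -/
def phiHO (θ : ℝ) (n m : ℕ) (lam s : ℕ → ℝ) : ℝ :=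
  (Real.Gamma θ)⁻¹ ^ (n * (m - n) + n * (n - 1) / 2) *
    ∫ μ in GTset m n lam,
      (Real.exp (∑ l ∈ Icc 1 m,
          s (l - 1) * (asum (min l n) (levT μ lam l) - asum (min (l - 1) n) (levT μ lam (l - 1)))) *
        ∏ i ∈ range n,
          (1 - Real.exp (-levT μ lam n i)) ^ (θ - 1) / (1 - Real.exp (-lam i)) ^ (θ - 1)) *
      ∏ l ∈ Ico 1 m,
        cross (min l n) (min (l + 1) n) (fun i => Real.exp (-levT μ lam l i))
            (fun i => Real.exp (-levT μ lam (l + 1) i)) ^ (θ - 1) /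
          (vand (min l n) (fun i => Real.exp (-levT μ lam l i)) ^ (θ - 1) *
            vand (min (l + 1) n) (fun i => Real.exp (-levT μ lam (l + 1) i)) ^ (θ - 1)) *
        Real.exp ((θ - 1) * asum (min l n) (levT μ lam l))

/-- The Heckman–Opdam hypergeometric function `F^{n,m}_β(λ, s)`, `θ = β/2`. -/
def hoF (θ : ℝ) (n m : ℕ) (lam s : ℕ → ℝ) : ℝ :=
  gammaProd θ n m / Real.Gamma θ ^ n *
    (phiHO θ n m lam s /
      (vandTrig n lam ^ θ * ∏ i ∈ range n, (1 - Real.exp (-lam i)) ^ (θ * ((m - n : ℕ) : ℝ))))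

/-- The conjugate Heckman–Opdam hypergeometric function `F̃^{n,m}_β(λ, s)`. -/
def hoFC (θ : ℝ) (n m : ℕ) (lam s : ℕ → ℝ) : ℝ :=
  (Real.Gamma θ)⁻¹ ^ n * (∏ i ∈ range n, (1 - Real.exp (-lam i)) ^ (θ - 1)) * hoF θ n m lam s

/-! ### Ensembles -/

/-- Support of an `m`-level ensemble: interlacing chain with non-negative entries. -/
def chainSupp {m n : ℕ} (μ : Arr m n) : Prop :=
  (∀ l, 1 ≤ l → l < m → interlaces (min l n) (min (l + 1) n) (lev μ l) (lev μ (l + 1))) ∧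
  ∀ l i, 1 ≤ l → l ≤ m → i < min l n → 0 ≤ lev μ l i

/-- Unnormalized density of the multivariate Bessel ensemble. -/
def mvbDensity (θ : ℝ) (n m : ℕ) (piv pih : ℕ → ℝ) : Arr m n → ℝ :=
  Set.indicator {μ | chainSupp μ} fun μ =>
    vand (min m n) (lev μ m) ^ θ *
    Real.exp (-θ * ∑ l ∈ Icc 1 m,
      pih (l - 1) * (asum (min l n) (lev μ l) - asum (min (l - 1) n) (lev μ (l - 1)))) *
    (∏ i ∈ range (min m n), lev μ m i ^ (θ * ((n - min n m : ℕ) : ℝ))) *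
    (∏ i ∈ range (min n m), lev μ (min n m) i ^ (θ - 1) / lev μ m i ^ (θ - 1)) *
    (∏ l ∈ Ico 1 m,
      cross (min l n) (min (l + 1) n) (lev μ l) (lev μ (l + 1)) ^ (θ - 1) /
        (vand (min l n) (lev μ l) ^ (θ - 1) * vand (min (l + 1) n) (lev μ (l + 1)) ^ (θ - 1))) *
    mvBesselC θ (min n m) n (lev μ m) fun i => -θ * piv i

/-- Unnormalized density of the Heckman–Opdam ensemble. -/
def hoDensity (θ : ℝ) (n m : ℕ) (piv pih : ℕ → ℝ) : Arr m n → ℝ :=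
  Set.indicator {μ | chainSupp μ} fun μ =>
    vandTrig (min m n) (lev μ m) ^ θ *
    (∏ i ∈ range (min m n), (1 - Real.exp (-lev μ m i)) ^ (θ * ((n - min m n : ℕ) : ℝ))) *
    (∏ i ∈ range (min m n),
      (1 - Real.exp (-lev μ (min m n) i)) ^ (θ - 1) / (1 - Real.exp (-lev μ m i)) ^ (θ - 1)) *
    Real.exp (-θ * ∑ l ∈ Icc 1 m,
      pih (l - 1) * (asum (min l n) (lev μ l) - asum (min (l - 1) n) (lev μ (l - 1)))) *
    (∏ l ∈ Ico 1 m,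
      cross (min l n) (min (l + 1) n) (fun i => Real.exp (-lev μ l i))
          (fun i => Real.exp (-lev μ (l + 1) i)) ^ (θ - 1) /
        (vand (min l n) (fun i => Real.exp (-lev μ l i)) ^ (θ - 1) *
          vand (min (l + 1) n) (fun i => Real.exp (-lev μ (l + 1) i)) ^ (θ - 1)) *
      Real.exp ((θ - 1) * asum (min l n) (lev μ l))) *
    hoFC θ (min m n) n (lev μ m) fun i => -θ * piv i

/-! ### Random matrices -/

instance matMeasurableSpace (m n : ℕ) (α : Type*) [MeasurableSpace α] :
    MeasurableSpace (Matrix (Fin m) (Fin n) α) :=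
  inferInstanceAs (MeasurableSpace (Fin m → Fin n → α))

/-- Eigenvalues (real parts of the roots of the characteristic polynomial, with
multiplicity) of a complex matrix, sorted in decreasing order; `0` beyond index `n`. -/
def eigsDesc {n : ℕ} (M : Matrix (Fin n) (Fin n) ℂ) : ℕ → ℝ := fun i =>
  (((M.charpoly.roots.map Complex.re).toList.insertionSort (· ≥ ·)).getD i 0)

/-- `(B^T B)` for the first `k` rows of `B`. -/
def gramR {n : ℕ} (k : ℕ) (B : ℕ → Fin n → ℝ) : Matrix (Fin n) (Fin n) ℝ :=
  Matrix.of fun a b => ∑ i ∈ range k, B i a * B i b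

/-- `(B^* B)` for the first `k` rows of `B`. -/
def gramC {n : ℕ} (k : ℕ) (B : ℕ → Fin n → ℂ) : Matrix (Fin n) (Fin n) ℂ :=
  Matrix.of fun a b => ∑ i ∈ range k, (starRingEnd ℂ) (B i a) * B i b

/-- decreasing eigenvalues of the level-`k` real Wishart matrix built from rows of `B` -/
def wishEigR {n : ℕ} (k : ℕ) (B : ℕ → Fin n → ℝ) : ℕ → ℝ :=
  eigsDesc ((gramR k B).map Complex.ofReal)

/-- decreasing eigenvalues of the level-`k` complex Wishart matrix built from rows of `B` -/
def wishEigC {n : ℕ} (k : ℕ) (B : ℕ → Fin n → ℂ) : ℕ → ℝ :=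
  eigsDesc (gramC k B)

/-- the multilevel array of nonzero Wishart eigenvalues (real entries) -/
def wishArrR (n m : ℕ) {Ω : Type*} (A : ℕ → Fin n → Ω → ℝ) (ω : Ω) : Arr m n :=
  fun p => wishEigR (p.1.1 + 1) (fun i j => A i j ω) p.1.2

/-- the multilevel array of nonzero Wishart eigenvalues (complex entries) -/
def wishArrC (n m : ℕ) {Ω : Type*} (A : ℕ → Fin n → Ω → ℂ) (ω : Ω) : Arr m n :=
  fun p => wishEigC (p.1.1 + 1) (fun i j => A i j ω) p.1.2

/-- The complex Gaussian distribution with mean `0` and variance `v = E|z|²`. -/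
def complexGaussian (v : ℝ) : Measure ℂ :=
  Measure.map (fun p : ℝ × ℝ => (⟨p.1, p.2⟩ : ℂ))
    ((gaussianReal 0 (v / 2).toNNReal).prod (gaussianReal 0 (v / 2).toNNReal))

/-- Law of the first `m` levels of eigenvalue arrays of the real generalized Wishart
ensemble with parameters `(p, 0)`. -/
def wishartLawR (n m : ℕ) (p : Fin n → ℝ) : Measure (Arr m n) :=
  Measure.map
    (fun Z : Fin m × Fin n → ℝ => fun c : { q // q ∈ coords m n } =>
      wishEigR (c.1.1 + 1) (fun i j => if h : i < m then Z (⟨i, h⟩, j) else 0) c.1.2)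
    (Measure.pi fun q : Fin m × Fin n => gaussianReal 0 ((p q.2)⁻¹).toNNReal)

/-- Law of the first `m` levels of eigenvalue arrays of the complex generalized Wishart
ensemble with parameters `(p, 0)`. -/
def wishartLawC (n m : ℕ) (p : Fin n → ℝ) : Measure (Arr m n) :=
  Measure.map
    (fun Z : Fin m × Fin n → ℂ => fun c : { q // q ∈ coords m n } =>
      wishEigC (c.1.1 + 1) (fun i j => if h : i < m then Z (⟨i, h⟩, j) else 0) c.1.2)
    (Measure.pi fun q : Fin m × Fin n => complexGaussian (p q.2)⁻¹)

/-! ### Haar-type measures and HCIZ integrals -/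

/-- `ν` is the Haar probability measure on the orthogonal group `O(n)` (identified with the
unique left-invariant probability measure carried by `O(n) ⊆ Matrix (Fin n) (Fin n) ℝ`). -/
def IsHaarOrth (n : ℕ) (ν : Measure (Matrix (Fin n) (Fin n) ℝ)) : Prop :=
  IsProbabilityMeasure ν ∧
    ν ((↑(Matrix.orthogonalGroup (Fin n) ℝ) : Set (Matrix (Fin n) (Fin n) ℝ))ᶜ) = 0 ∧
    ∀ U ∈ Matrix.orthogonalGroup (Fin n) ℝ, Measure.map (fun V => U * V) ν = ν

/-- `ν` is the Haar probability measure on the unitary group `U(n)`. -/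
def IsHaarUnitary (n : ℕ) (ν : Measure (Matrix (Fin n) (Fin n) ℂ)) : Prop :=
  IsProbabilityMeasure ν ∧
    ν ((↑(Matrix.unitaryGroup (Fin n) ℂ) : Set (Matrix (Fin n) (Fin n) ℂ))ᶜ) = 0 ∧
    ∀ U ∈ Matrix.unitaryGroup (Fin n) ℂ, Measure.map (fun V => U * V) ν = ν

/-- first `k` entries of `x`, padded with zeros, as a `Fin n`-vector -/
def pad (n : ℕ) (x : ℕ → ℝ) (k : ℕ) : Fin n → ℝ := fun j => if (j : ℕ) < k then x j else 0

/-- The real HCIZ integral `h¹_a(b) = ∫_{O(n)} e^{-Tr(V a Vᵀ b)/2} dν` with `a` of length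
`ka` and `b` of length `kb`, both padded by zeros. -/
def hcizR (n : ℕ) (ν : Measure (Matrix (Fin n) (Fin n) ℝ)) (a : ℕ → ℝ) (ka : ℕ)
    (b : ℕ → ℝ) (kb : ℕ) : ℝ :=
  ∫ V, Real.exp (-(Matrix.trace (V * Matrix.diagonal (pad n a ka) * V.transpose *
    Matrix.diagonal (pad n b kb))) / 2) ∂ν

/-! ### Jacobi matrices -/

/-- `J_l = (X^{An})^* X^{An} ((X^{An})^* X^{An} + (Y^{ln})^* Y^{ln})⁻¹`, real entries. -/
def jacMatR (A n l : ℕ) (X Y : ℕ → ℕ → ℝ) : Matrix (Fin n) (Fin n) ℝ :=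
  (Matrix.of fun a b : Fin n => ∑ i ∈ range A, X i a * X i b) *
    ((Matrix.of fun a b : Fin n => ∑ i ∈ range A, X i a * X i b) +
      Matrix.of fun a b : Fin n => ∑ i ∈ range l, Y i a * Y i b)⁻¹

/-- `J_l`, complex entries. -/
def jacMatC (A n l : ℕ) (X Y : ℕ → ℕ → ℂ) : Matrix (Fin n) (Fin n) ℂ :=
  (Matrix.of fun a b : Fin n => ∑ i ∈ range A, (starRingEnd ℂ) (X i a) * X i b) *
    ((Matrix.of fun a b : Fin n => ∑ i ∈ range A, (starRingEnd ℂ) (X i a) * X i b) +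
      Matrix.of fun a b : Fin n => ∑ i ∈ range l, (starRingEnd ℂ) (Y i a) * Y i b)⁻¹

/-- `λ^l_i` (0-based `i < l`): the `i`-th largest among the `l` smallest eigenvalues of
`J_l` (real case). -/
def jacEigR (A n l : ℕ) (X Y : ℕ → ℕ → ℝ) (i : ℕ) : ℝ :=
  eigsDesc ((jacMatR A n l X Y).map Complex.ofReal) (n - l + i)

/-- `λ^l_i` (complex case). -/
def jacEigC (A n l : ℕ) (X Y : ℕ → ℕ → ℂ) (i : ℕ) : ℝ :=
  eigsDesc (jacMatC A n l X Y) (n - l + i)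

/-! ### q-analysis -/

/-- finite q-Pochhammer `(x; q)_N` -/
def qpoch (x q : ℝ) (N : ℕ) : ℝ := ∏ k ∈ range N, (1 - x * q ^ k)

/-- infinite q-Pochhammer `(x; q)_∞` -/
def qpochInf (x q : ℝ) : ℝ := ∏' k : ℕ, (1 - x * q ^ k)

/-- `f(u) = (tu; q)_∞/(qu; q)_∞` -/
def macf (q t u : ℝ) : ℝ := qpochInf (t * u) q / qpochInf (q * u) q

/-- Macdonald norm constant `b_ν(q, t)` (1-based parts `ν 1 ≥ ν 2 ≥ ⋯ ≥ ν n`, `ν (n+1) = 0`). -/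
def bMac (n : ℕ) (ν : ℕ → ℕ) (q t : ℝ) : ℝ :=
  ∏ l ∈ Icc 1 n, ∏ i ∈ range l,
    qpoch (t ^ (i + 1) * q ^ (ν (l - i) - ν l)) q (ν l - ν (l + 1)) /
      qpoch (t ^ i * q ^ (ν (l - i) - ν l + 1)) q (ν l - ν (l + 1))

/-- Macdonald branching coefficient `ψ^m_{λ/μ}(q, t)` (0-based index sequences). -/
def psiMac (m : ℕ) (lam mu : ℕ → ℝ) (q t : ℝ) : ℝ :=
  ∏ i ∈ range (m - 1), ∏ j ∈ range (m - 1),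
    if i ≤ j then
      macf q t (q ^ (mu i - mu j) * t ^ (j - i)) *
          macf q t (q ^ (lam i - lam (j + 1)) * t ^ (j - i)) /
        (macf q t (q ^ (mu i - lam (j + 1)) * t ^ (j - i)) *
          macf q t (q ^ (lam i - mu j) * t ^ (j - i)))
    else 1

/-- Truncated Macdonald branching coefficient (0-based index sequences of length `n`). -/
def psiMacT (n : ℕ) (lam mu : ℕ → ℝ) (q t : ℝ) : ℝ :=
  (∏ i ∈ range n, ∏ j ∈ range n,
    if i < j then
      macf q t (q ^ (mu i - mu j) * t ^ (j - i)) *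
          macf q t (q ^ (lam i - lam j) * t ^ (j - i - 1)) /
        (macf q t (q ^ (lam i - mu j) * t ^ (j - i)) *
          macf q t (q ^ (mu i - lam j) * t ^ (j - i - 1)))
    else 1) *
  (∏ i ∈ range n, macf q t 1 / macf q t (q ^ (lam i - mu i))) *
  ∏ i ∈ range n, macf q t (q ^ lam i * t ^ (n - 1 - i)) / macf q t (q ^ mu i * t ^ (n - 1 - i))

/-- Transition kernel density of the β = 1 generalized Wishart eigenvalue chain
(`prev` = level `m-1`, argument = level `m`). -/
def wishKer1 (n : ℕ) (piv pih : ℕ → ℝ) (ν : Measure (Matrix (Fin n) (Fin n) ℝ)) (m : ℕ)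
    (prev : ℕ → ℝ) : (ℕ → ℝ) → ℝ :=
  Set.indicator {y | interlaces (min (m - 1) n) (min m n) prev y} fun y =>
    (∏ i ∈ range n, (piv i + pih (m - 1)) ^ ((1 : ℝ) / 2)) /
        (Real.Gamma (m / 2) * Real.Gamma (1 / 2) ^ m) *
      Real.exp (-(1 / 2) * pih (m - 1) * (asum (min m n) y - asum (min (m - 1) n) prev)) *
      ((∏ i ∈ range (min m n),
          y i ^ (((n : ℝ) - min m n - if m ≤ n then 1 else 0) / 2)) /
        ∏ i ∈ range (min (m - 1) n),
          prev i ^ (((n : ℝ) - min (m - 1) n - if m ≤ n then 1 else 0) / 2)) *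
      (hcizR n ν piv n y (min m n) / hcizR n ν piv n prev (min (m - 1) n)) *
      (vand (min m n) y * cross (min m n) (min (m - 1) n) y prev ^ (-(1 : ℝ) / 2))

/-- Support of the multilevel Jacobi ensemble: interlacing with entries in `[0,1]`. -/
def jacSupp {m n : ℕ} (μ : Arr m n) : Prop :=
  (∀ l, 1 ≤ l → l < m → interlaces (min l n) (min (l + 1) n) (lev μ l) (lev μ (l + 1))) ∧
  ∀ l i, 1 ≤ l → l ≤ m → i < min l n → lev μ l i ∈ Set.Icc (0 : ℝ) 1

/-- Unnormalized density of the first `m` levels of the β = 2 Jacobi ensemble. -/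
def jacDens2 (A n m : ℕ) : Arr m n → ℝ :=
  Set.indicator {μ | jacSupp μ} fun μ =>
    vand (min m n) (lev μ m) *
    (∏ i ∈ range (min m n),
      lev μ m i ^ ((A : ℝ) + m - n - 1) * (1 - lev μ m i) ^ ((n : ℝ) - m)) *
    ∏ l ∈ Ico 1 m, ∏ i ∈ range (min l n), lev μ l i ^ (-2 : ℝ)

/-- Unnormalized density of the first `m` levels of the β = 1 Jacobi ensemble. -/
def jacDens1 (A n m : ℕ) : Arr m n → ℝ :=
  Set.indicator {μ | jacSupp μ} fun μ =>
    vand (min m n) (lev μ m) *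
    (∏ i ∈ range (min m n),
      lev μ m i ^ (((A : ℝ) + m - n - 4) / 2) * (1 - lev μ m i) ^ (((n : ℝ) - m + 1) / 2)) *
    ∏ l ∈ Ico 1 m,
      (∏ i ∈ range (min l n), lev μ l i ^ (-1 : ℝ)) * vand (min l n) (lev μ l) *
        cross (min l n) (min (l + 1) n) (lev μ l) (lev μ (l + 1)) ^ (-(1 : ℝ) / 2)

/-- `(X^{An})^T X^{An}` (real). -/
def SxR (A n : ℕ) (X : ℕ → ℕ → ℝ) : Matrix (Fin n) (Fin n) ℝ :=
  Matrix.of fun a b : Fin n => ∑ i ∈ range A, X i a * X i b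

/-- `(X^{An})^* X^{An}` (complex). -/
def SxC (A n : ℕ) (X : ℕ → ℕ → ℂ) : Matrix (Fin n) (Fin n) ℂ :=
  Matrix.of fun a b : Fin n => ∑ i ∈ range A, (starRingEnd ℂ) (X i a) * X i b

/-- The array `{λ^l_i}_{1 ≤ i ≤ l ≤ m}` of Jacobi eigenvalues (real case). -/
def jacArrR (A n m : ℕ) (X Y : ℕ → ℕ → ℝ) : Arr m n :=
  fun c => jacEigR A n (c.1.1 + 1) X Y c.1.2

/-- The array `{λ^l_i}_{1 ≤ i ≤ l ≤ m}` of Jacobi eigenvalues (complex case). -/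
def jacArrC (A n m : ℕ) (X Y : ℕ → ℕ → ℂ) : Arr m n :=
  fun c => jacEigC A n (c.1.1 + 1) X Y c.1.2

/-- The array `{τ^l_i = (λ^l_{l+1-i})⁻¹ - 1}` (real case). -/
def tauArrR (A n m : ℕ) (X Y : ℕ → ℕ → ℝ) : Arr m n :=
  fun c => (eigsDesc ((jacMatR A n (c.1.1 + 1) X Y).map Complex.ofReal) (n - 1 - c.1.2))⁻¹ - 1

/-- The array `{τ^l_i = (λ^l_{l+1-i})⁻¹ - 1}` (complex case). -/
def tauArrC (A n m : ℕ) (X Y : ℕ → ℕ → ℂ) : Arr m n :=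
  fun c => (eigsDesc (jacMatC A n (c.1.1 + 1) X Y) (n - 1 - c.1.2))⁻¹ - 1


/-! ### Helper lemmas: sorted eigenvalues -/

lemma eigsDesc_of_charpoly {n : ℕ} (M : Matrix (Fin n) (Fin n) ℂ) (z : Fin n → ℂ)
    (hz : Antitone fun i => (z i).re)
    (h : M.charpoly = ∏ i, (Polynomial.X - Polynomial.C (z i))) (i : ℕ) :
    eigsDesc M i = if hi : i < n then (z ⟨i, hi⟩).re else 0 := by
  have hroots : M.charpoly.roots = Multiset.map z Finset.univ.val := by
    rw [h, Polynomial.roots_prod]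
    · simp
    · simp [Finset.prod_ne_zero_iff, Polynomial.X_sub_C_ne_zero]
  have hsort : (M.charpoly.roots.map Complex.re).toList.insertionSort (· ≥ ·)
      = List.ofFn (fun i => (z i).re) := by
    have hp : (M.charpoly.roots.map Complex.re).toList.Perm (List.ofFn (fun i => (z i).re)) := by
      rw [← Multiset.coe_eq_coe, Multiset.coe_toList, hroots, Multiset.map_map,
        Fin.univ_val_map]
      rfl
    have hs : (List.ofFn (fun i => (z i).re)).Pairwise (· ≥ ·) := by
      rw [← List.sortedGE_iff_pairwise]
      exact hz.sortedGE_ofFn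
    exact List.Perm.eq_of_pairwise (fun a b _ _ h1 h2 => le_antisymm h2 h1)
      (List.pairwise_insertionSort (· ≥ ·) _) hs ((List.perm_insertionSort _ _).trans hp)
  unfold eigsDesc
  rw [hsort]
  split_ifs with hi
  · simp [List.getD_eq_getElem?_getD, hi]
  · simp [List.getD_eq_getElem?_getD, hi]

lemma exists_antitone_perm {n : ℕ} (d : Fin n → ℝ) :
    ∃ e : Equiv.Perm (Fin n), Antitone fun i => d (e i) := by
  refine ⟨Tuple.sort (fun i => - d i), fun i j hij => ?_⟩
  have := Tuple.monotone_sort (fun i => - d i) hij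
  simpa using this

lemma exists_charpoly_prod {n : ℕ} (M : Matrix (Fin n) (Fin n) ℂ) :
    ∃ z : Fin n → ℂ, (Antitone fun i => (z i).re) ∧
      M.charpoly = ∏ i, (Polynomial.X - Polynomial.C (z i)) := by
  have hsp : M.charpoly.Splits := IsAlgClosed.splits _
  have hcard : M.charpoly.roots.toList.length = n := by
    rw [Multiset.length_toList, ← hsp.natDegree_eq_card_roots, Matrix.charpoly_natDegree_eq_dim,
      Fintype.card_fin]
  let w : Fin n → ℂ := fun i => M.charpoly.roots.toList.get (i.cast hcard.symm)
  have hw : Multiset.map w Finset.univ.val = M.charpoly.roots := by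
    rw [Fin.univ_val_map]
    conv_rhs => rw [← Multiset.coe_toList M.charpoly.roots]
    congr 1
    apply List.ext_get
    · simp [hcard]
    · intro k h1 h2
      simp [w]
  have hprod : M.charpoly = ∏ i, (Polynomial.X - Polynomial.C (w i)) := by
    have := hsp.eq_prod_roots_of_monic (Matrix.charpoly_monic M)
    rw [this, ← hw, Multiset.map_map]
    rfl
  obtain ⟨e, he⟩ := exists_antitone_perm fun i => (w i).re
  refine ⟨fun i => w (e i), he, ?_⟩
  rw [hprod]
  exact (Equiv.prod_comp e (fun i => Polynomial.X - Polynomial.C (w i))).symm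

lemma continuous_coeff_prod {n : ℕ} (s : Finset (Fin n)) (k : ℕ) :
    Continuous fun z : Fin n → ℂ => (∏ i ∈ s, (Polynomial.X - Polynomial.C (z i))).coeff k := by
  induction s using Finset.induction_on generalizing k with
  | empty => simpa using continuous_const
  | insert a s ha ih =>
    simp only [Finset.prod_insert ha, sub_mul, Polynomial.coeff_sub, Polynomial.coeff_C_mul]
    refine Continuous.sub ?_ ((continuous_apply a).mul (ih k))
    cases k with
    | zero => simpa using continuous_const
    | succ k => simpa [Polynomial.coeff_X_mul] using ih k

lemma measurable_coeff_charpoly {n : ℕ} {α : Type*} [MeasurableSpace α]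
    (φ : α → Matrix (Fin n) (Fin n) ℂ) (hφ : ∀ i j, Measurable fun a => φ a i j) (k : ℕ) :
    Measurable fun a => (φ a).charpoly.coeff k := by
  have : ∀ a, (φ a).charpoly.coeff k = MvPolynomial.eval (fun p : Fin n × Fin n => φ a p.1 p.2)
      ((Matrix.charpoly.univ ℂ (Fin n)).coeff k) := by
    intro a
    have h := congrArg (fun p => Polynomial.coeff p k)
      (Matrix.charpoly.univ_map_eval₂Hom (Fin n) (RingHom.id ℂ)
        (fun p : Fin n × Fin n => φ a p.1 p.2))
    simp only [Polynomial.coeff_map] at h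
    exact h.symm
  simp only [this]
  have hc : Continuous fun v : Fin n × Fin n → ℂ =>
      MvPolynomial.eval v ((Matrix.charpoly.univ ℂ (Fin n)).coeff k) :=
    MvPolynomial.continuous_eval _
  exact hc.measurable.comp (measurable_pi_lambda _ fun p => hφ p.1 p.2)

lemma measurable_eigsDesc {n : ℕ} {α : Type*} [MeasurableSpace α]
    (φ : α → Matrix (Fin n) (Fin n) ℂ) (hφ : ∀ i j, Measurable fun a => φ a i j) (k : ℕ) :
    Measurable fun a => eigsDesc (φ a) k := by
  by_cases hk : k < n
  swap
  · have : ∀ a, eigsDesc (φ a) k = 0 := by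
      intro a
      obtain ⟨z, hz, h⟩ := exists_charpoly_prod (φ a)
      rw [eigsDesc_of_charpoly _ z hz h, dif_neg hk]
    simp only [this]
    exact measurable_const
  refine measurable_of_Iic fun t => ?_
  let K : Set (Fin n → ℂ) := {z | (Antitone fun i => (z i).re) ∧ (z ⟨k, hk⟩).re ≤ t}
  let Φ : (Fin n → ℂ) → (Fin (n + 1) → ℂ) := fun z j =>
    (∏ i, (Polynomial.X - Polynomial.C (z i))).coeff j
  have hΦ : Continuous Φ := continuous_pi fun j => continuous_coeff_prod _ _
  have hK : IsClosed K := by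
    have : K = (⋂ i, ⋂ j, ⋂ (_ : i ≤ j), {z : Fin n → ℂ | (z j).re ≤ (z i).re}) ∩
        {z | (z ⟨k, hk⟩).re ≤ t} := by
      ext z
      simp [K, Antitone]
    rw [this]
    refine IsClosed.inter ?_ ?_
    · refine isClosed_iInter fun i => isClosed_iInter fun j => isClosed_iInter fun _ => ?_
      exact isClosed_le (by fun_prop) (by fun_prop)
    · exact isClosed_le (by fun_prop) (by fun_prop)
  have hKs : IsSigmaCompact K := isSigmaCompact_univ.of_isClosed_subset hK (Set.subset_univ _)
  have hI : MeasurableSet (Φ '' K) := by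
    obtain ⟨C, hC, hCK⟩ := hKs.image hΦ
    rw [← hCK]
    exact MeasurableSet.iUnion fun i => (hC i).measurableSet
  have hm : Measurable fun a => (fun j : Fin (n + 1) => (φ a).charpoly.coeff (j : ℕ)) :=
    measurable_pi_lambda _ fun j => measurable_coeff_charpoly φ hφ j
  have heq : (fun a => eigsDesc (φ a) k) ⁻¹' Set.Iic t
      = (fun a => (fun j : Fin (n + 1) => (φ a).charpoly.coeff (j : ℕ))) ⁻¹' (Φ '' K) := by
    ext a
    simp only [Set.mem_preimage, Set.mem_Iic, Set.mem_image]
    constructor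
    · intro h
      obtain ⟨z, hz, hp⟩ := exists_charpoly_prod (φ a)
      rw [eigsDesc_of_charpoly _ z hz hp, dif_pos hk] at h
      exact ⟨z, ⟨hz, h⟩, by funext j; simp [Φ, hp]⟩
    · rintro ⟨z, ⟨hz, ht⟩, hp⟩
      have hp' : (φ a).charpoly = ∏ i, (Polynomial.X - Polynomial.C (z i)) := by
        ext j
        by_cases hj : j < n + 1
        · exact (congrFun hp ⟨j, hj⟩).symm
        · rw [Polynomial.coeff_eq_zero_of_natDegree_lt, Polynomial.coeff_eq_zero_of_natDegree_lt]
          · rw [Polynomial.natDegree_finsetProd_X_sub_C_eq_card]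
            simp; omega
          · rw [Matrix.charpoly_natDegree_eq_dim]
            simp; omega
      rw [eigsDesc_of_charpoly _ z hz hp', dif_pos hk]
      exact ht
  rw [heq]
  exact hm hI

/-! ### Helper lemmas: spectral decompositions -/

lemma exists_spectral {𝕜 : Type*} [RCLike 𝕜] {n : ℕ} (S : Matrix (Fin n) (Fin n) 𝕜)
    (hS : S.IsHermitian) :
    ∃ (U : Matrix (Fin n) (Fin n) 𝕜) (d : Fin n → ℝ), Antitone d ∧
      U.conjTranspose * U = 1 ∧ U * U.conjTranspose = 1 ∧
      U.conjTranspose * S * U = Matrix.diagonal (fun i => (d i : 𝕜)) := by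
  obtain ⟨e, he⟩ := exists_antitone_perm hS.eigenvalues
  set V : Matrix (Fin n) (Fin n) 𝕜 := (hS.eigenvectorUnitary : Matrix (Fin n) (Fin n) 𝕜) with hV
  have h1 : V.conjTranspose * V = 1 := by
    have := Matrix.mem_unitaryGroup_iff'.1 hS.eigenvectorUnitary.2
    simpa [Matrix.star_eq_conjTranspose] using this
  have h3 : V.conjTranspose * S * V = Matrix.diagonal (fun i => (hS.eigenvalues i : 𝕜)) := by
    have h := hS.spectral_theorem
    rw [Unitary.conjStarAlgAut_apply] at h
    change S = V * _ * V.conjTranspose at h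
    conv_lhs => rw [h]
    calc V.conjTranspose * (V * Matrix.diagonal (RCLike.ofReal ∘ hS.eigenvalues)
            * V.conjTranspose) * V
        = (V.conjTranspose * V) * Matrix.diagonal (RCLike.ofReal ∘ hS.eigenvalues)
            * (V.conjTranspose * V) := by simp only [Matrix.mul_assoc]
      _ = _ := by rw [h1]; simp [Function.comp_def]
  have h1' : (V.submatrix id e).conjTranspose * V.submatrix id e = 1 := by
    rw [Matrix.conjTranspose_submatrix, ← Matrix.submatrix_mul _ _ _ _ _ Function.bijective_id, h1]
    simp
  refine ⟨V.submatrix id e, fun i => hS.eigenvalues (e i), he, h1', ?_, ?_⟩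
  · exact mul_eq_one_comm.1 h1'
  · have : (V.submatrix id e).conjTranspose * S * V.submatrix id e
        = (V.conjTranspose * S * V).submatrix e e := by
      rw [Matrix.conjTranspose_submatrix, Matrix.submatrix_mul _ _ _ _ _ Function.bijective_id,
        Matrix.submatrix_mul _ _ _ _ _ Function.bijective_id, Matrix.submatrix_id_id]
    rw [this, h3]
    ext i j
    simp [Matrix.diagonal_apply]

lemma eigsDesc_of_spectral {n : ℕ} (S U : Matrix (Fin n) (Fin n) ℂ) (d : Fin n → ℝ)
    (hd : Antitone d) (hU : U * U.conjTranspose = 1)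
    (h : U.conjTranspose * S * U = Matrix.diagonal (fun i => (d i : ℂ))) (i : Fin n) :
    eigsDesc S i = d i := by
  have hp : S.charpoly = ∏ i, (Polynomial.X - Polynomial.C ((d i : ℂ))) := by
    have : (U.conjTranspose * (S * U)).charpoly = (S * U * U.conjTranspose).charpoly :=
      Matrix.charpoly_mul_comm _ _
    rw [Matrix.mul_assoc S, hU, Matrix.mul_one, ← Matrix.mul_assoc, h] at this
    rw [← this, Matrix.charpoly_diagonal]
  rw [eigsDesc_of_charpoly S (fun i => (d i : ℂ)) (by simpa using hd) hp]
  simp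

lemma gramC_eq {n : ℕ} (k : ℕ) (B : ℕ → Fin n → ℂ) :
    gramC k B = (Matrix.of fun (i : Fin k) j => B i j).conjTranspose *
      (Matrix.of fun (i : Fin k) j => B i j) := by
  ext a b
  simp [gramC, Matrix.mul_apply, Finset.sum_range]

lemma gramC_mul {n : ℕ} (k : ℕ) (B : ℕ → Fin n → ℂ) (T : Matrix (Fin n) (Fin n) ℂ) :
    gramC k (fun i j => ∑ l, B i l * T l j) = T.conjTranspose * gramC k B * T := by
  have : (Matrix.of fun (i : Fin k) j => ∑ l, B i l * T l j)
      = (Matrix.of fun (i : Fin k) j => B i j) * T := by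
    ext i j; simp [Matrix.mul_apply]
  rw [gramC_eq, gramC_eq, this, Matrix.conjTranspose_mul]
  simp only [Matrix.mul_assoc]

open scoped ComplexOrder in
/-- deterministic identity between transformed Jacobi eigenvalues and Wishart eigenvalues -/
lemma tau_eq_wish {n : ℕ} (l : ℕ) (S T : Matrix (Fin n) (Fin n) ℂ) (B : ℕ → Fin n → ℂ)
    (hT : T.conjTranspose * S * T = 1) (i : ℕ) (hi : i < n) :
    (eigsDesc (S * (S + gramC l B)⁻¹) (n - 1 - i))⁻¹ - 1
      = wishEigC l (fun i j => ∑ k, B i k * T k j) i := by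
  have hW := gramC_mul l B T
  set W := gramC l (fun i j => ∑ k, B i k * T k j) with hWdef
  have hWps : W.PosSemidef := by
    rw [hWdef, gramC_eq]; exact Matrix.posSemidef_conjTranspose_mul_self _
  obtain ⟨V, d, hd, hV1, hV2, hVd0⟩ := exists_spectral W hWps.isHermitian
  have hVd : V.conjTranspose * W * V = Matrix.diagonal (fun i => (d i : ℂ)) := hVd0
  have hd0 : ∀ i, 0 ≤ d i := by
    intro i
    have h1 : (V.conjTranspose * W * V).PosSemidef := hWps.conjTranspose_mul_mul_same V
    rw [hVd] at h1
    have := (Matrix.posSemidef_diagonal_iff.1 h1) i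
    exact_mod_cast this
  have hwish : wishEigC l (fun i j => ∑ k, B i k * T k j) i = d ⟨i, hi⟩ :=
    eigsDesc_of_spectral W V d hd hV2 hVd ⟨i, hi⟩
  rw [hwish]
  set Q := T * V with hQ
  have hQS : Q.conjTranspose * S * Q = 1 := by
    calc Q.conjTranspose * S * Q = V.conjTranspose * (T.conjTranspose * S * T) * V := by
          simp only [hQ, Matrix.conjTranspose_mul, Matrix.mul_assoc]
      _ = 1 := by rw [hT, Matrix.mul_one, hV1]
  have hQG : Q.conjTranspose * gramC l B * Q = Matrix.diagonal (fun i => (d i : ℂ)) := by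
    rw [← hVd, hW]
    simp only [hQ, Matrix.conjTranspose_mul, Matrix.mul_assoc]
  set E : Matrix (Fin n) (Fin n) ℂ := Matrix.diagonal (fun i => (((1 + d i)⁻¹ : ℝ) : ℂ)) with hE
  have hQ1 : Q.conjTranspose * (S + gramC l B) * Q * E = 1 := by
    rw [Matrix.mul_add, Matrix.add_mul, hQS, hQG, ← Matrix.diagonal_one, Matrix.diagonal_add, hE,
      Matrix.diagonal_mul_diagonal]
    congr 1
    funext i
    have : (1 + d i) ≠ 0 := by have := hd0 i; positivity
    have h2 : (1 + (d i : ℂ)) ≠ 0 := by exact_mod_cast this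
    push_cast
    field_simp
  have hinv : (S + gramC l B)⁻¹ = Q * E * Q.conjTranspose := by
    apply Matrix.inv_eq_right_inv
    have : Q.conjTranspose * ((S + gramC l B) * Q * E) = 1 := by
      rw [← hQ1]; simp only [Matrix.mul_assoc]
    have := mul_eq_one_comm.1 this
    rw [← this]; simp only [Matrix.mul_assoc]
  have hcp : (S * (S + gramC l B)⁻¹).charpoly
      = ∏ i, (Polynomial.X - Polynomial.C ((((1 + d (Fin.rev i))⁻¹ : ℝ) : ℂ))) := by
    rw [hinv]
    have h1 : S * (Q * E * Q.conjTranspose) = (S * Q * E) * Q.conjTranspose := by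
      simp only [Matrix.mul_assoc]
    rw [h1, Matrix.charpoly_mul_comm]
    have h2 : Q.conjTranspose * (S * Q * E) = E := by
      rw [← Matrix.one_mul E, ← hQS]; simp only [Matrix.mul_assoc, hQS]
      rw [← Matrix.mul_assoc S Q, ← Matrix.mul_assoc Q.conjTranspose, ← Matrix.mul_assoc Q.conjTranspose, hQS]
      simp
    rw [h2, hE, Matrix.charpoly_diagonal]
    exact (Equiv.prod_comp Fin.revPerm
      (fun i => Polynomial.X - Polynomial.C ((((1 + d i)⁻¹ : ℝ) : ℂ)))).symm
  rw [eigsDesc_of_charpoly _ (fun i => (((1 + d (Fin.rev i))⁻¹ : ℝ) : ℂ)) _ hcp]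
  · have h3 : n - 1 - i < n := by omega
    rw [dif_pos h3, Complex.ofReal_re, inv_inv]
    have : Fin.rev ⟨n - 1 - i, h3⟩ = ⟨i, hi⟩ := by
      ext; simp [Fin.rev]; omega
    rw [this]; ring
  · intro a b hab
    simp only [Complex.ofReal_re]
    have h4 := hd (Fin.rev_le_rev.2 hab)
    have h5 := hd0 (Fin.rev a)
    exact inv_anti₀ (by positivity) (by linarith)

/-! ### Helper lemmas: Gaussian vectors -/

lemma sum_normSq_unitary {𝕜 : Type*} [RCLike 𝕜] {n : ℕ} (U : Matrix (Fin n) (Fin n) 𝕜)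
    (hU : U.conjTranspose * U = 1) (t : Fin n → 𝕜) :
    ∑ k, ‖∑ j, t j * star (U k j)‖ ^ 2 = ∑ j, ‖t j‖ ^ 2 := by
  have hw : (fun k => ∑ j, t j * star (U k j)) = Matrix.vecMul t U.conjTranspose := by
    funext k
    simp [Matrix.vecMul, dotProduct]
  have key : Matrix.vecMul t U.conjTranspose ⬝ᵥ star (Matrix.vecMul t U.conjTranspose)
      = t ⬝ᵥ star t := by
    rw [Matrix.star_vecMul, Matrix.conjTranspose_conjTranspose, ← Matrix.dotProduct_mulVec,
      Matrix.mulVec_mulVec, hU, Matrix.one_mulVec]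
  rw [← hw] at key
  have h2 : ∀ v : Fin n → 𝕜, v ⬝ᵥ star v = ((∑ j, ‖v j‖ ^ 2 : ℝ) : 𝕜) := by
    intro v
    simp [dotProduct, RCLike.mul_conj]
  rw [h2, h2] at key
  exact_mod_cast key

lemma rotation_invariant {𝕜 : Type*} [RCLike 𝕜] [MeasurableSpace 𝕜] [BorelSpace 𝕜]
    (γ : Measure 𝕜) [IsProbabilityMeasure γ] (c : ℝ)
    (hγ : ∀ t : 𝕜, ∫ x, Complex.exp ((RCLike.re (x * star t) : ℝ) * Complex.I) ∂γ
      = Complex.exp ((-c * ‖t‖ ^ 2 : ℝ)))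
    {m n : ℕ} (U : Matrix (Fin n) (Fin n) 𝕜) (hU : U.conjTranspose * U = 1) :
    Measure.map (fun (y : Fin m × Fin n → 𝕜) (q : Fin m × Fin n) => ∑ k, y (q.1, k) * U k q.2)
      (Measure.pi fun _ => γ) = Measure.pi fun _ => γ := by
  have hinner : ∀ x t : 𝕜, inner ℝ x t = RCLike.re (x * star t) := by
    intro x t
    rw [real_inner_comm, real_inner_eq_re_inner 𝕜, RCLike.inner_apply]
    rfl
  have hcf : ∀ t : 𝕜, charFun γ t = Complex.exp ((-c * ‖t‖ ^ 2 : ℝ)) := by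
    intro t
    rw [charFun_apply, ← hγ t]
    simp only [hinner]
  have hLm : Measurable (fun (y : Fin m × Fin n → 𝕜) (q : Fin m × Fin n) =>
      ∑ k, y (q.1, k) * U k q.2) := by
    refine measurable_pi_lambda _ fun q => ?_
    refine Finset.measurable_sum _ fun k _ => ?_
    exact (measurable_pi_apply _).mul_const _
  have : IsProbabilityMeasure (Measure.map (fun (y : Fin m × Fin n → 𝕜) (q : Fin m × Fin n) =>
      ∑ k, y (q.1, k) * U k q.2) (Measure.pi fun _ => γ)) :=
    Measure.isProbabilityMeasure_map hLm.aemeasurable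
  rw [← charFun_eq_pi_iff]
  intro t
  let s : PiLp 2 (fun _ : Fin m × Fin n => 𝕜) :=
    WithLp.toLp 2 (fun q : Fin m × Fin n => ∑ j, t (q.1, j) * star (U q.2 j))
  have h1 := charFun_pi (μ := fun _ : Fin m × Fin n => γ) s
  have h2 : charFun (Measure.map (WithLp.toLp 2) (Measure.map
      (fun (y : Fin m × Fin n → 𝕜) (q : Fin m × Fin n) =>
      ∑ k, y (q.1, k) * U k q.2) (Measure.pi fun _ => γ))) t
      = charFun (Measure.map (WithLp.toLp 2) (Measure.pi fun _ : Fin m × Fin n => γ)) s := by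
    rw [charFun_apply, charFun_apply, ← MeasurableEquiv.coe_toLp, integral_map_equiv,
      integral_map_equiv, integral_map hLm.aemeasurable]
    · congr 1
      funext y
      congr 3
      simp only [MeasurableEquiv.coe_toLp, PiLp.inner_apply, hinner, s]
      rw [← map_sum, ← map_sum]
      congr 1
      rw [Fintype.sum_prod_type, Fintype.sum_prod_type]
      refine Finset.sum_congr rfl fun r _ => ?_
      simp only [star_sum, Finset.sum_mul, Finset.mul_sum, star_mul', star_star]
      rw [Finset.sum_comm]
      refine Finset.sum_congr rfl fun i _ => Finset.sum_congr rfl fun j _ => ?_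
      ring
    · refine Continuous.aestronglyMeasurable ?_
      simp only [MeasurableEquiv.coe_toLp]
      fun_prop
  rw [h2, h1]
  simp only [hcf, ← Complex.exp_sum]
  congr 1
  rw [← Complex.ofReal_sum, ← Complex.ofReal_sum]
  congr 1
  rw [← Finset.mul_sum, ← Finset.mul_sum, Fintype.sum_prod_type, Fintype.sum_prod_type]
  congr 1
  refine Finset.sum_congr rfl fun r _ => ?_
  exact sum_normSq_unitary U hU fun j => t (r, j)

lemma gaussian_mul_matrix {𝕜 : Type*} [RCLike 𝕜] [MeasurableSpace 𝕜] [BorelSpace 𝕜]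
    (γ : ℝ → Measure 𝕜) (hprob : ∀ v, IsProbabilityMeasure (γ v)) (c : ℝ)
    (hγ : ∀ t : 𝕜, ∫ x, Complex.exp ((RCLike.re (x * star t) : ℝ) * Complex.I) ∂(γ 1)
      = Complex.exp ((-c * ‖t‖ ^ 2 : ℝ)))
    (hscale : ∀ r : ℝ, 0 ≤ r → Measure.map (fun x : 𝕜 => x * (r : 𝕜)) (γ 1) = γ (r ^ 2))
    {m n : ℕ} (U : Matrix (Fin n) (Fin n) 𝕜) (hU : U.conjTranspose * U = 1)
    (r : Fin n → ℝ) (hr : ∀ i, 0 ≤ r i) :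
    Measure.map (fun (y : Fin m × Fin n → 𝕜) (q : Fin m × Fin n) =>
        ∑ k, y (q.1, k) * (U * Matrix.diagonal fun i => (r i : 𝕜)) k q.2)
      (Measure.pi fun _ => γ 1) = Measure.pi fun q => γ (r q.2 ^ 2) := by
  have := hprob
  have h1 := rotation_invariant (m := m) (γ 1) c hγ U hU
  have h2 := Measure.pi_map_pi (μ := fun _ : Fin m × Fin n => γ 1)
    (f := fun (q : Fin m × Fin n) (x : 𝕜) => x * (r q.2 : 𝕜))
    (fun q => (measurable_id.mul_const _).aemeasurable)
  simp only [hscale _ (hr _)] at h2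
  rw [← h2]
  conv_rhs => rw [← h1]
  rw [Measure.map_map]
  · congr 1
    funext y q
    simp [Matrix.mul_diagonal, Finset.sum_mul, mul_assoc]
  · refine measurable_pi_lambda _ fun q => ?_
    exact (measurable_pi_apply _).mul_const _
  · refine measurable_pi_lambda _ fun q => ?_
    refine Finset.measurable_sum _ fun k _ => ?_
    exact (measurable_pi_apply _).mul_const _

/-! ### Helper lemmas: almost sure invertibility -/

lemma pi_absolutelyContinuous {E : Type*} [MeasurableSpace E] (μ ν : Measure E) [SigmaFinite μ]
    [SigmaFinite ν] (h : μ ≪ ν) (ι : Type) [Fintype ι] :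
    Measure.pi (fun _ : ι => μ) ≪ Measure.pi (fun _ : ι => ν) := by
  refine Fintype.induction_empty_option (P := fun (ι : Type) _ =>
    Measure.pi (fun _ : ι => μ) ≪ Measure.pi (fun _ : ι => ν)) ?_ ?_ ?_ ι
  · intro α β _ e ih
    let _ := Fintype.ofEquiv β e.symm
    have h1 := Measure.pi_map_piCongrLeft e (fun _ : β => μ)
    have h2 := Measure.pi_map_piCongrLeft e (fun _ : β => ν)
    rw [← h1, ← h2]
    exact ih.map (MeasurableEquiv.measurable _)
  · rw [Measure.pi_of_empty, Measure.pi_of_empty]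
  · intro α _ ih
    have h1 := Measure.pi_map_piOptionEquivProd (fun _ : Option α => μ)
    have h2 := Measure.pi_map_piOptionEquivProd (fun _ : Option α => ν)
    rw [← h1, ← h2]
    exact (ih.prod h).map (MeasurableEquiv.measurable _)

lemma ae_det_ne_zero {𝕜 : Type*} [RCLike 𝕜] [MeasurableSpace 𝕜] [BorelSpace 𝕜]
    (ν : Measure 𝕜) [SigmaFinite ν] [NullSingletonClass ν] [NeZero ν] [ν.IsAddRightInvariant]
    {A n : ℕ} (hnA : n ≤ A) :
    ∀ᵐ x ∂(Measure.pi fun _ : Fin A × Fin n => ν),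
      (Matrix.of fun i j : Fin n => x (Fin.castLE hnA i, j)).det ≠ 0 := by
  let D : (Fin A × Fin n → 𝕜) → 𝕜 := fun x =>
    (Matrix.of fun i j : Fin n => x (Fin.castLE hnA i, j)).det
  have hD : Continuous D := by
    refine Continuous.matrix_det ?_
    exact continuous_matrix fun i j => continuous_apply _
  let e : Fin A × Fin n → 𝕜 := fun q => if (q.1 : ℕ) = q.2 then 1 else 0
  have hjoint : ∀ᵐ x ∂(Measure.pi fun _ : Fin A × Fin n => ν), ∀ᵐ t ∂ν,
      D (x + t • e) ≠ 0 := by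
    refine Eventually.of_forall fun x => ?_
    let M : Matrix (Fin n) (Fin n) 𝕜 := Matrix.of fun i j : Fin n => x (Fin.castLE hnA i, j)
    have hM : ∀ t, D (x + t • e) = (-M).charpoly.eval t := by
      intro t
      rw [Matrix.eval_charpoly]
      simp only [D]
      congr 1
      ext i j
      simp [M, e, Matrix.scalar_apply, Matrix.diagonal_apply, Fin.ext_iff, add_comm]
    have hfin : {t : 𝕜 | D (x + t • e) = 0}.Finite := by
      refine ((-M).charpoly.roots.toFinset.finite_toSet).subset fun t ht => ?_
      have ht' : D (x + t • e) = 0 := ht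
      rw [hM] at ht'
      simp [(Matrix.charpoly_monic (-M)).ne_zero, ht', Polynomial.IsRoot]
    rw [ae_iff]
    simpa using hfin.measure_zero ν
  have hcomm : ∀ᵐ t ∂ν, ∀ᵐ x ∂(Measure.pi fun _ : Fin A × Fin n => ν), D (x + t • e) ≠ 0 := by
    rw [← Measure.ae_ae_comm]
    · exact hjoint
    · have hc : Continuous fun p : (Fin A × Fin n → 𝕜) × 𝕜 => D (p.1 + p.2 • e) :=
        hD.comp (by fun_prop)
      exact (isOpen_ne.preimage hc).measurableSet
  obtain ⟨t, ht⟩ := hcomm.exists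
  have hmp := measurePreserving_add_right (Measure.pi fun _ : Fin A × Fin n => ν) (t • e)
  rw [← hmp.map_eq]
  rw [ae_map_iff hmp.measurable.aemeasurable]
  · exact ht
  · exact (isOpen_ne.preimage hD).measurableSet

lemma isHermitian_gram {𝕜 : Type*} [RCLike 𝕜] {A n : ℕ} (x : Fin A × Fin n → 𝕜) :
    ((Matrix.of fun i j => x (i, j)).conjTranspose * (Matrix.of fun i j => x (i, j))).IsHermitian :=
  Matrix.isHermitian_conjTranspose_mul_self _

/-- the whitening transform of an invertible Gram matrix -/
lemma exists_whitening {𝕜 : Type*} [RCLike 𝕜] {A n : ℕ} (hnA : n ≤ A) (x : Fin A × Fin n → 𝕜)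
    (hx : (Matrix.of fun i j : Fin n => x (Fin.castLE hnA i, j)).det ≠ 0) :
    ∃ (U : Matrix (Fin n) (Fin n) 𝕜) (d : Fin n → ℝ), Antitone d ∧ (∀ i, 0 < d i) ∧
      U.conjTranspose * U = 1 ∧ U * U.conjTranspose = 1 ∧
      U.conjTranspose * ((Matrix.of fun i j => x (i, j)).conjTranspose *
        (Matrix.of fun i j => x (i, j))) * U = Matrix.diagonal (fun i => (d i : 𝕜)) := by
  obtain ⟨U, d, hd, h1, h2, h3⟩ := exists_spectral _ (isHermitian_gram x)
  refine ⟨U, d, hd, fun i => ?_, h1, h2, h3⟩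
  set v : Fin n → 𝕜 := fun k => U k i with hv
  set w : Fin A → 𝕜 := Matrix.mulVec (Matrix.of fun i j => x (i, j)) v with hw
  have hdi : d i = ∑ a, ‖w a‖ ^ 2 := by
    have h4 := congrFun (congrFun h3 i) i
    rw [Matrix.diagonal_apply_eq] at h4
    have h5 : U.conjTranspose * ((Matrix.of fun i j => x (i, j)).conjTranspose *
        (Matrix.of fun i j => x (i, j))) * U
        = ((Matrix.of fun i j => x (i, j)) * U).conjTranspose *
          ((Matrix.of fun i j => x (i, j)) * U) := by
      rw [Matrix.conjTranspose_mul]; simp only [Matrix.mul_assoc]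
    rw [h5, Matrix.mul_apply] at h4
    have h6 : ∀ a, ((Matrix.of fun i j => x (i, j)) * U) a i = w a := by
      intro a; simp [hw, Matrix.mulVec, dotProduct, Matrix.mul_apply, hv]
    simp only [Matrix.conjTranspose_apply, h6] at h4
    have h7 : ((d i : ℝ) : 𝕜) = ((∑ a, ‖w a‖ ^ 2 : ℝ) : 𝕜) := by
      rw [← h4]; simp [RCLike.conj_mul]
    exact_mod_cast h7
  have hnn : 0 ≤ d i := by rw [hdi]; positivity
  refine lt_of_le_of_ne hnn fun h0 => ?_
  rw [← h0] at hdi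
  have hz := (Finset.sum_eq_zero_iff_of_nonneg (fun a _ => by positivity)).1 hdi.symm
  have hmv : Matrix.mulVec (Matrix.of fun i j : Fin n => x (Fin.castLE hnA i, j)) v = 0 := by
    funext a
    have := hz (Fin.castLE hnA a) (Finset.mem_univ _)
    simpa [hw, Matrix.mulVec] using this
  have hv0 : v = 0 := Matrix.eq_zero_of_mulVec_eq_zero hx hmv
  have h8 := congrFun (congrFun h1 i) i
  rw [Matrix.mul_apply] at h8
  have h9 : ∀ k, U k i = 0 := fun k => congrFun hv0 k
  simp [h9] at h8

/-! ### The generic argument -/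

/-- extension of a finite matrix by zero -/
def exM {𝕜 : Type*} [Zero 𝕜] {A n : ℕ} (x : Fin A × Fin n → 𝕜) : ℕ → ℕ → 𝕜 := fun i j =>
  if h : i < A ∧ j < n then x (⟨i, h.1⟩, ⟨j, h.2⟩) else 0

lemma measurable_exM {𝕜 : Type*} [Zero 𝕜] [MeasurableSpace 𝕜] {A n : ℕ} (i j : ℕ) :
    Measurable fun x : Fin A × Fin n → 𝕜 => exM x i j := by
  unfold exM
  split_ifs
  · exact measurable_pi_apply _
  · exact measurable_const

lemma SxC_congr {A n : ℕ} {X X' : ℕ → ℕ → ℂ} (h : ∀ i < A, ∀ j < n, X i j = X' i j) :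
    SxC A n X = SxC A n X' := by
  ext a b
  simp only [SxC, Matrix.of_apply]
  refine Finset.sum_congr rfl fun i hi => ?_
  rw [h i (Finset.mem_range.1 hi) a a.2, h i (Finset.mem_range.1 hi) b b.2]

lemma gramC_congr {k n : ℕ} {X X' : ℕ → Fin n → ℂ} (h : ∀ i < k, ∀ j, X i j = X' i j) :
    gramC k X = gramC k X' := by
  ext a b
  simp only [gramC, Matrix.of_apply]
  refine Finset.sum_congr rfl fun i hi => ?_
  rw [h i (Finset.mem_range.1 hi) a, h i (Finset.mem_range.1 hi) b]

lemma jacMatC_eq (A n l : ℕ) (X Y : ℕ → ℕ → ℂ) :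
    jacMatC A n l X Y = SxC A n X * (SxC A n X + SxC l n Y)⁻¹ := rfl

lemma SxC_eq_gramC (l n : ℕ) (Y : ℕ → ℕ → ℂ) :
    SxC l n Y = gramC l fun i (j : Fin n) => Y i j := rfl

lemma tauArrC_congr {A n m : ℕ} {X X' Y Y' : ℕ → ℕ → ℂ}
    (hX : ∀ i < A, ∀ j < n, X i j = X' i j) (hY : ∀ i < m, ∀ j < n, Y i j = Y' i j) :
    tauArrC A n m X Y = tauArrC A n m X' Y' := by
  funext c
  simp only [tauArrC, jacMatC_eq]
  have hc : c.1.1 < m := by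
    have := c.2
    simp only [coords, Finset.mem_filter, Finset.mem_product, Finset.mem_range] at this
    exact this.1.1
  rw [SxC_congr hX, SxC_congr (A := c.1.1 + 1) (X := Y) (X' := Y')
    fun i hi j hj => hY i (by omega) j hj]

lemma measurable_SxC {A n : ℕ} {α : Type*} [MeasurableSpace α] (X : α → ℕ → ℕ → ℂ)
    (hX : ∀ i j, Measurable fun a => X a i j) (i j : Fin n) :
    Measurable fun a => SxC A n (X a) i j := by
  simp only [SxC, Matrix.of_apply]
  refine Finset.measurable_sum _ fun k _ => ?_
  exact (Complex.continuous_conj.measurable.comp (hX _ _)).mul (hX _ _)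

lemma measurable_matrix_inv {n : ℕ} {α : Type*} [MeasurableSpace α]
    (φ : α → Matrix (Fin n) (Fin n) ℂ) (hφ : ∀ i j, Measurable fun a => φ a i j) (i j : Fin n) :
    Measurable fun a => (φ a)⁻¹ i j := by
  have hdet : ∀ ψ : α → Matrix (Fin n) (Fin n) ℂ, (∀ i j, Measurable fun a => ψ a i j) →
      Measurable fun a => (ψ a).det := by
    intro ψ hψ
    simp only [Matrix.det_apply']
    exact Finset.measurable_sum _ fun σ _ =>
      (Finset.measurable_prod _ fun k _ => hψ _ _).const_mul _
  have hadj : Measurable fun a => (φ a).adjugate i j := by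
    simp only [Matrix.adjugate_apply]
    refine hdet _ fun k l => ?_
    simp only [Matrix.updateRow_apply]
    split_ifs
    · exact measurable_const
    · exact hφ _ _
  have : ∀ a, (φ a)⁻¹ i j = ((φ a).det)⁻¹ * (φ a).adjugate i j := by
    intro a
    rw [Matrix.inv_def, Matrix.smul_apply, Ring.inverse_eq_inv', smul_eq_mul]
  simp only [this]
  exact (hdet _ hφ).inv.mul hadj

lemma measurable_tauArrC {A n m : ℕ} {α : Type*} [MeasurableSpace α] (X Y : α → ℕ → ℕ → ℂ)
    (hX : ∀ i j, Measurable fun a => X a i j) (hY : ∀ i j, Measurable fun a => Y a i j) :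
    Measurable fun a => tauArrC A n m (X a) (Y a) := by
  refine measurable_pi_lambda _ fun c => ?_
  simp only [tauArrC, jacMatC_eq]
  refine Measurable.sub_const (Measurable.inv ?_) 1
  refine measurable_eigsDesc _ (fun i j => ?_) _
  simp only [Matrix.mul_apply]
  refine Finset.measurable_sum _ fun k _ => ?_
  refine (measurable_SxC X hX _ _).mul ?_
  refine measurable_matrix_inv _ (fun i j => ?_) _ _
  simp only [Matrix.add_apply]
  exact (measurable_SxC X hX _ _).add (measurable_SxC Y hY _ _)

/-- the generic Wishart eigenvalue map -/
def wishMap {𝕜 : Type*} [RCLike 𝕜] (ι : 𝕜 →+* ℂ) (m n : ℕ) (Z : Fin m × Fin n → 𝕜) : Arr m n :=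
  fun c => wishEigC (c.1.1 + 1) (fun i j => if h : i < m then ι (Z (⟨i, h⟩, j)) else 0) c.1.2

lemma measurable_wishMap {𝕜 : Type*} [RCLike 𝕜] [MeasurableSpace 𝕜] [BorelSpace 𝕜]
    (ι : 𝕜 →+* ℂ) (hιc : Continuous ι) (m n : ℕ) : Measurable (wishMap ι m n) := by
  refine measurable_pi_lambda _ fun c => ?_
  refine measurable_eigsDesc _ (fun a b => ?_) _
  simp only [gramC, Matrix.of_apply]
  refine Finset.measurable_sum _ fun k _ => ?_
  have : ∀ j, Measurable fun Z : Fin m × Fin n → 𝕜 =>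
      if h : k < m then ι (Z (⟨k, h⟩, j)) else 0 := by
    intro j
    split_ifs
    · exact hιc.measurable.comp (measurable_pi_apply _)
    · exact measurable_const
  exact (Complex.continuous_conj.measurable.comp (this _)).mul (this _)

lemma SxC_exM {𝕜 : Type*} [RCLike 𝕜] (ι : 𝕜 →+* ℂ) (hιs : ∀ z, ι (star z) = star (ι z))
    {A n : ℕ} (x : Fin A × Fin n → 𝕜) :
    SxC A n (fun i k => ι (exM x i k)) = ((Matrix.of fun i j => x (i, j)).conjTranspose *
        (Matrix.of fun i j => x (i, j))).map ι := by
  ext a b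
  simp only [SxC, Matrix.of_apply, Matrix.map_apply, Matrix.mul_apply, Matrix.conjTranspose_apply,
    map_sum, map_mul, hιs, Finset.sum_range]
  refine Finset.sum_congr rfl fun i _ => ?_
  simp [exM]

lemma map_conjTranspose_ringHom {𝕜 : Type*} [RCLike 𝕜] (ι : 𝕜 →+* ℂ)
    (hιs : ∀ z, ι (star z) = star (ι z)) {n : ℕ} (M : Matrix (Fin n) (Fin n) 𝕜) :
    (M.map ι).conjTranspose = M.conjTranspose.map ι := by
  ext a b
  simp only [Matrix.conjTranspose_apply, Matrix.map_apply, hιs]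

lemma lintegral_tau_eq {𝕜 : Type*} [RCLike 𝕜] [MeasurableSpace 𝕜] [BorelSpace 𝕜]
    (γ : ℝ → Measure 𝕜) (hprob : ∀ v, IsProbabilityMeasure (γ v)) (c : ℝ)
    (hγ : ∀ t : 𝕜, ∫ x, Complex.exp ((RCLike.re (x * star t) : ℝ) * Complex.I) ∂(γ 1)
      = Complex.exp ((-c * ‖t‖ ^ 2 : ℝ)))
    (hscale : ∀ r : ℝ, 0 ≤ r → Measure.map (fun x : 𝕜 => x * (r : 𝕜)) (γ 1) = γ (r ^ 2))
    (ι : 𝕜 →+* ℂ) (hιc : Continuous ι) (hιs : ∀ z, ι (star z) = star (ι z))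
    (hιr : ∀ r : ℝ, ι (r : 𝕜) = (r : ℂ))
    {A n m : ℕ} (hnA : n ≤ A) (x : Fin A × Fin n → 𝕜)
    (hx : (Matrix.of fun i j : Fin n => x (Fin.castLE hnA i, j)).det ≠ 0)
    (f : Arr m n → ℝ≥0∞) (hf : Measurable f) :
    ∫⁻ y, f (tauArrC A n m (fun i k => ι (exM x i k)) (fun i k => ι (exM y i k)))
        ∂(Measure.pi fun _ : Fin m × Fin n => γ 1)
      = ∫⁻ a, f a ∂(Measure.map (wishMap ι m n) (Measure.pi fun q : Fin m × Fin n =>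
          γ (eigsDesc (SxC A n (fun i k => ι (exM x i k))) (q.2 : ℕ))⁻¹)) := by
  obtain ⟨U, d, hd, hpos, hU1, hU2, hUd⟩ := exists_whitening hnA x hx
  set S : Matrix (Fin n) (Fin n) 𝕜 := (Matrix.of fun i j => x (i, j)).conjTranspose *
        (Matrix.of fun i j => x (i, j)) with hS
  have hSx : SxC A n (fun i k => ι (exM x i k)) = S.map ι := SxC_exM ι hιs x
  have hlam : ∀ j : Fin n, eigsDesc (SxC A n (fun i k => ι (exM x i k))) (j : ℕ) = d j := by
    intro j
    refine eigsDesc_of_spectral _ (U.map ι) d hd ?_ ?_ j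
    · rw [map_conjTranspose_ringHom ι hιs, ← Matrix.map_mul, hU2]
      simp
    · rw [map_conjTranspose_ringHom ι hιs, hSx, ← Matrix.map_mul, ← Matrix.map_mul, hUd,
        Matrix.diagonal_map (map_zero ι)]
      simp only [hιr]
  simp only [hlam]
  let r : Fin n → ℝ := fun i => Real.sqrt (d i)⁻¹
  have hr : ∀ i, 0 ≤ r i := fun i => Real.sqrt_nonneg _
  have hr2 : ∀ i, r i ^ 2 = (d i)⁻¹ := fun i =>
    Real.sq_sqrt (inv_nonneg.2 (hpos i).le)
  set T : Matrix (Fin n) (Fin n) 𝕜 := U * Matrix.diagonal fun i => (r i : 𝕜) with hTdef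
  have hlaw := gaussian_mul_matrix (m := m) γ hprob c hγ hscale U hU1 r hr
  simp only [hr2] at hlaw
  have hTS : T.conjTranspose * S * T = 1 := by
    have h1 : T.conjTranspose * S * T = (Matrix.diagonal fun i => (r i : 𝕜)).conjTranspose *
        (U.conjTranspose * S * U) * (Matrix.diagonal fun i => (r i : 𝕜)) := by
      rw [hTdef, Matrix.conjTranspose_mul]; simp only [Matrix.mul_assoc]
    rw [h1, hUd, Matrix.diagonal_conjTranspose, Matrix.diagonal_mul_diagonal,
      Matrix.diagonal_mul_diagonal, ← Matrix.diagonal_one]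
    congr 1
    funext i
    have h2 : r i * d i * r i = 1 := by
      have := hr2 i
      have h0 := (hpos i).ne'
      calc r i * d i * r i = r i ^ 2 * d i := by ring
        _ = 1 := by rw [this]; field_simp
    simp only [Pi.star_apply, RCLike.star_def, RCLike.conj_ofReal]
    exact_mod_cast h2
  have hTS' : (T.map ι).conjTranspose * (S.map ι) * T.map ι = 1 := by
    rw [map_conjTranspose_ringHom ι hιs, ← Matrix.map_mul, ← Matrix.map_mul, hTS]
    simp
  have hLm : Measurable (fun (y : Fin m × Fin n → 𝕜) (q : Fin m × Fin n) =>
      ∑ k, y (q.1, k) * T k q.2) := by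
    refine measurable_pi_lambda _ fun q => ?_
    refine Finset.measurable_sum _ fun k _ => ?_
    exact (measurable_pi_apply _).mul_const _
  have hWm := measurable_wishMap ι hιc m n
  rw [← hlaw, Measure.map_map hWm hLm, lintegral_map hf (hWm.comp hLm)]
  refine lintegral_congr fun y => ?_
  congr 1
  funext p
  have hp := p.2
  simp only [coords, Finset.mem_filter, Finset.mem_product, Finset.mem_range] at hp
  simp only [tauArrC, jacMatC_eq, hSx, Function.comp, wishMap]
  rw [SxC_eq_gramC, tau_eq_wish (p.1.1 + 1) (S.map ι) (T.map ι) _ hTS' p.1.2 hp.1.2]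
  unfold wishEigC
  congr 1
  refine gramC_congr fun i hi j => ?_
  have him : i < m := by omega
  simp [exM, him]

theorem generic_jacobi_wishart {𝕜 : Type*} [RCLike 𝕜] [MeasurableSpace 𝕜] [BorelSpace 𝕜]
    (γ : ℝ → Measure 𝕜) (hprob : ∀ v, IsProbabilityMeasure (γ v)) (c : ℝ)
    (hγ : ∀ t : 𝕜, ∫ x, Complex.exp ((RCLike.re (x * star t) : ℝ) * Complex.I) ∂(γ 1)
      = Complex.exp ((-c * ‖t‖ ^ 2 : ℝ)))
    (hscale : ∀ r : ℝ, 0 ≤ r → Measure.map (fun x : 𝕜 => x * (r : 𝕜)) (γ 1) = γ (r ^ 2))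
    (ν : Measure 𝕜) [SigmaFinite ν] [NullSingletonClass ν] [NeZero ν] [ν.IsAddRightInvariant]
    (hac : γ 1 ≪ ν)
    (ι : 𝕜 →+* ℂ) (hιc : Continuous ι) (hιs : ∀ z, ι (star z) = star (ι z))
    (hιr : ∀ r : ℝ, ι (r : 𝕜) = (r : ℂ))
    {A n m : ℕ} (hnA : n ≤ A)
    {Ω : Type} [MeasurableSpace Ω] (P : Measure Ω) [IsProbabilityMeasure P]
    (X Y : ℕ → ℕ → Ω → 𝕜) (hX : ∀ i j, Measurable (X i j)) (hY : ∀ i j, Measurable (Y i j))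
    (hind : iIndepFun
        (Sum.elim (fun p : ℕ × ℕ => X p.1 p.2) (fun p : ℕ × ℕ => Y p.1 p.2)) P)
    (hXl : ∀ i j, Measure.map (X i j) P = γ 1) (hYl : ∀ i j, Measure.map (Y i j) P = γ 1)
    (f : Arr m n → ℝ≥0∞) (hf : Measurable f) (g : (Fin n → ℝ) → ℝ≥0∞) (hg : Measurable g) :
    ∫⁻ ω, g (fun j => eigsDesc (SxC A n fun i k => ι (X i k ω)) (j : ℕ)) *
            f (tauArrC A n m (fun i k => ι (X i k ω)) fun i k => ι (Y i k ω)) ∂P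
          = ∫⁻ ω, g (fun j => eigsDesc (SxC A n fun i k => ι (X i k ω)) (j : ℕ)) *
              ∫⁻ a, f a ∂(Measure.map (wishMap ι m n) (Measure.pi fun q : Fin m × Fin n =>
          γ (eigsDesc (SxC A n (fun i k => ι (X i k ω))) (q.2 : ℕ))⁻¹)) ∂P := by
  have := hprob
  let xp : Ω → Fin A × Fin n → 𝕜 := fun ω q => X q.1 q.2 ω
  let yp : Ω → Fin m × Fin n → 𝕜 := fun ω q => Y q.1 q.2 ω
  have hxm : Measurable xp := measurable_pi_lambda _ fun q => hX _ _
  have hym : Measurable yp := measurable_pi_lambda _ fun q => hY _ _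
  -- the joint law
  let emb : (Fin A × Fin n) ⊕ (Fin m × Fin n) → (ℕ × ℕ) ⊕ (ℕ × ℕ) :=
    Sum.map (fun q => ((q.1 : ℕ), (q.2 : ℕ))) (fun q => ((q.1 : ℕ), (q.2 : ℕ)))
  have hemb : Function.Injective emb := by
    refine Function.Injective.sumMap ?_ ?_
    · rintro ⟨a, b⟩ ⟨a', b'⟩ h
      simpa [Fin.ext_iff] using h
    · rintro ⟨a, b⟩ ⟨a', b'⟩ h
      simpa [Fin.ext_iff] using h
  have hind2 := hind.precomp hemb
  have hlaw := (iIndepFun_iff_map_fun_eq_pi_map (fun s => by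
    rcases s with s | s
    · exact (hX _ _).aemeasurable
    · exact (hY _ _).aemeasurable)).1 hind2
  have hlaw2 : Measure.map (fun ω s => (Sum.elim (xp ω) (yp ω) : _ → 𝕜) s) P
      = Measure.pi fun _ : (Fin A × Fin n) ⊕ (Fin m × Fin n) => γ 1 := by
    convert hlaw using 2
    · funext ω s
      rcases s with s | s <;> rfl
    · funext s
      rcases s with s | s
      · exact (hXl _ _).symm
      · exact (hYl _ _).symm
  have hmp := measurePreserving_sumPiEquivProdPi
    (fun _ : (Fin A × Fin n) ⊕ (Fin m × Fin n) => γ 1)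
  have hjoint : Measure.map (fun ω => (xp ω, yp ω)) P
      = (Measure.pi fun _ : Fin A × Fin n => γ 1).prod (Measure.pi fun _ : Fin m × Fin n => γ 1) := by
    rw [← hmp.map_eq, ← hlaw2, Measure.map_map hmp.measurable]
    · rfl
    · refine measurable_pi_lambda _ fun s => ?_
      rcases s with s | s
      · exact hX _ _
      · exact hY _ _
  have hxlaw : Measure.map xp P = Measure.pi fun _ : Fin A × Fin n => γ 1 := by
    have h1 : Measure.map xp P = Measure.map Prod.fst (Measure.map (fun ω => (xp ω, yp ω)) P) := by
      rw [Measure.map_map measurable_fst (hxm.prodMk hym)]; rfl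
    rw [h1, hjoint, Measure.map_fst_prod]
    simp
  -- replace by the finite arrays
  have hSx : ∀ ω, SxC A n (fun i k => ι (X i k ω)) = SxC A n (fun i k => ι (exM (xp ω) i k)) := by
    intro ω
    refine SxC_congr fun i hi j hj => ?_
    simp [exM, hi, hj, xp]
  have htau : ∀ ω, tauArrC A n m (fun i k => ι (X i k ω)) (fun i k => ι (Y i k ω))
      = tauArrC A n m (fun i k => ι (exM (xp ω) i k)) (fun i k => ι (exM (yp ω) i k)) := by
    intro ω
    refine tauArrC_congr (fun i hi j hj => ?_) (fun i hi j hj => ?_)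
    · simp [exM, hi, hj, xp]
    · simp [exM, hi, hj, yp]
  simp only [hSx, htau]
  let G : (Fin A × Fin n → 𝕜) → ℝ≥0∞ := fun x =>
    g (fun j => eigsDesc (SxC A n fun i k => ι (exM x i k)) (j : ℕ))
  have hG : Measurable G := by
    refine hg.comp (measurable_pi_lambda _ fun j => ?_)
    refine measurable_eigsDesc _ (fun a b => ?_) _
    exact measurable_SxC _ (fun i j => hιc.measurable.comp (measurable_exM i j)) a b
  let F : (Fin A × Fin n → 𝕜) × (Fin m × Fin n → 𝕜) → ℝ≥0∞ := fun p =>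
    f (tauArrC A n m (fun i k => ι (exM p.1 i k)) fun i k => ι (exM p.2 i k))
  have hF : Measurable F := by
    refine hf.comp (measurable_tauArrC _ _ (fun i j => ?_) (fun i j => ?_))
    · exact hιc.measurable.comp ((measurable_exM i j).comp measurable_fst)
    · exact hιc.measurable.comp ((measurable_exM i j).comp measurable_snd)
  have hGF : Measurable fun p : (Fin A × Fin n → 𝕜) × (Fin m × Fin n → 𝕜) => G p.1 * F p :=
    (hG.comp measurable_fst).mul hF
  have hae : ∀ᵐ ω ∂P,
      (Matrix.of fun i j : Fin n => xp ω (Fin.castLE hnA i, j)).det ≠ 0 := by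
    have h1 := (pi_absolutelyContinuous (γ 1) ν hac (Fin A × Fin n)).ae_le (ae_det_ne_zero ν hnA)
    have h2 : ∀ᵐ x ∂(Measure.map xp P),
        (Matrix.of fun i j : Fin n => x (Fin.castLE hnA i, j)).det ≠ 0 := by
      rw [hxlaw]; exact h1
    exact ae_of_ae_map hxm.aemeasurable h2
  calc ∫⁻ ω, G (xp ω) * F (xp ω, yp ω) ∂P
      = ∫⁻ p, G p.1 * F p ∂(Measure.map (fun ω => (xp ω, yp ω)) P) := by
        rw [lintegral_map hGF (hxm.prodMk hym)]
    _ = ∫⁻ x, ∫⁻ y, G x * F (x, y) ∂(Measure.pi fun _ : Fin m × Fin n => γ 1)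
          ∂(Measure.pi fun _ : Fin A × Fin n => γ 1) := by
        rw [hjoint, lintegral_prod _ hGF.aemeasurable]
    _ = ∫⁻ ω, ∫⁻ y, G (xp ω) * F (xp ω, y) ∂(Measure.pi fun _ : Fin m × Fin n => γ 1) ∂P := by
        rw [← hxlaw, lintegral_map hGF.lintegral_prod_right' hxm]
    _ = _ := by
        refine lintegral_congr_ae ?_
        filter_upwards [hae] with ω hω
        have hFy : Measurable fun y => F (xp ω, y) := hF.comp measurable_prodMk_left
        rw [lintegral_const_mul _ hFy]
        congr 1
        exact lintegral_tau_eq γ hprob c hγ hscale ι hιc hιs hιr hnA (xp ω) hω f hf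

lemma SxR_map (A n : ℕ) (X : ℕ → ℕ → ℝ) :
    (SxR A n X).map Complex.ofReal = SxC A n fun i k => Complex.ofRealHom (X i k) := by
  ext a b
  simp [SxR, SxC]

lemma matrix_map_inv {n : ℕ} (M : Matrix (Fin n) (Fin n) ℝ) :
    (M⁻¹).map Complex.ofReal = (M.map Complex.ofReal)⁻¹ := by
  have hd : (M.map Complex.ofReal).det = ((M.det : ℝ) : ℂ) :=
    (RingHom.map_det Complex.ofRealHom M).symm
  have ha : (M.map Complex.ofReal).adjugate = (M.adjugate).map Complex.ofReal :=
    (RingHom.map_adjugate Complex.ofRealHom M).symm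
  rw [Matrix.inv_def, Matrix.inv_def, hd, ha]
  ext a b
  simp [Ring.inverse_eq_inv']

lemma jacMatR_map (A n l : ℕ) (X Y : ℕ → ℕ → ℝ) :
    (jacMatR A n l X Y).map Complex.ofReal
      = jacMatC A n l (fun i k => Complex.ofRealHom (X i k))
        (fun i k => Complex.ofRealHom (Y i k)) := by
  have h1 : jacMatR A n l X Y = SxR A n X * (SxR A n X + SxR l n Y)⁻¹ := rfl
  have h2 : ∀ M N : Matrix (Fin n) (Fin n) ℝ, (M * N).map Complex.ofReal
      = M.map Complex.ofReal * N.map Complex.ofReal :=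
    fun M N => Matrix.map_mul (f := Complex.ofRealHom)
  have h3 : ∀ M N : Matrix (Fin n) (Fin n) ℝ, (M + N).map Complex.ofReal
      = M.map Complex.ofReal + N.map Complex.ofReal := by
    intro M N
    ext a b
    simp
  rw [h1, jacMatC_eq, h2, matrix_map_inv, h3, SxR_map, SxR_map]

lemma tauArrR_eq (A n m : ℕ) (X Y : ℕ → ℕ → ℝ) :
    tauArrR A n m X Y = tauArrC A n m (fun i k => Complex.ofRealHom (X i k))
        (fun i k => Complex.ofRealHom (Y i k)) := by
  funext c
  simp only [tauArrR, tauArrC, jacMatR_map]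

lemma wishartLawR_eq (n m : ℕ) (p : Fin n → ℝ) :
    wishartLawR n m p = Measure.map (wishMap Complex.ofRealHom m n)
      (Measure.pi fun q : Fin m × Fin n => gaussianReal 0 ((p q.2)⁻¹).toNNReal) := by
  unfold wishartLawR
  congr 1
  funext Z c
  simp only [wishMap, wishEigR, wishEigC]
  congr 1
  ext a b
  simp only [gramR, gramC, Matrix.map_apply, Matrix.of_apply, Complex.ofReal_sum,
    Complex.ofReal_mul]
  refine Finset.sum_congr rfl fun i _ => ?_
  split_ifs <;> simp

lemma wishartLawC_eq (n m : ℕ) (p : Fin n → ℝ) :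
    wishartLawC n m p = Measure.map (wishMap (RingHom.id ℂ) m n)
      (Measure.pi fun q : Fin m × Fin n => complexGaussian (p q.2)⁻¹) := rfl

lemma gaussianReal_integral_exp (v : ℝ≥0) (t : ℝ) :
    ∫ x, Complex.exp (((t * x : ℝ) : ℂ) * Complex.I) ∂(gaussianReal 0 v)
      = Complex.exp ((-(v / 2) * t ^ 2 : ℝ)) := by
  have h := charFun_gaussianReal (μ := 0) (v := v) t
  rw [charFun_apply_real] at h
  push_cast at h ⊢
  rw [h]
  congr 1
  simp
  ring

lemma gaussianReal_scale (r : ℝ) (v : ℝ) :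
    Measure.map (fun x : ℝ => x * r) (gaussianReal 0 v.toNNReal)
      = gaussianReal 0 (r ^ 2 * v).toNNReal := by
  rw [gaussianReal_map_mul_const, mul_zero]
  congr 1
  rw [Real.toNNReal_mul (sq_nonneg r)]
  congr 1
  ext
  simp [Real.coe_toNNReal _ (sq_nonneg r)]

lemma measurable_mkC : Measurable fun p : ℝ × ℝ => (⟨p.1, p.2⟩ : ℂ) :=
  Complex.measurableEquivRealProd.symm.measurable

instance isProbabilityMeasure_complexGaussian (v : ℝ) :
    IsProbabilityMeasure (complexGaussian v) :=
  Measure.isProbabilityMeasure_map measurable_mkC.aemeasurable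

lemma complexGaussian_integral (t : ℂ) :
    ∫ x, Complex.exp ((RCLike.re (x * star t) : ℝ) * Complex.I) ∂(complexGaussian 1)
      = Complex.exp ((-(1 / 4) * ‖t‖ ^ 2 : ℝ)) := by
  unfold complexGaussian
  have hc : Continuous fun x : ℂ =>
      Complex.exp ((RCLike.re (x * star t) : ℝ) * Complex.I) := by
    have : Continuous fun x : ℂ => (RCLike.re (x * star t) : ℝ) :=
      RCLike.continuous_re.comp (continuous_id.mul continuous_const)
    exact Complex.continuous_exp.comp ((Complex.continuous_ofReal.comp this).mul continuous_const)
  rw [integral_map measurable_mkC.aemeasurable hc.aestronglyMeasurable]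
  have h : ∀ p : ℝ × ℝ, Complex.exp
      ((RCLike.re ((⟨p.1, p.2⟩ : ℂ) * star t) : ℝ) * Complex.I)
      = Complex.exp (((t.re * p.1 : ℝ) : ℂ) * Complex.I)
        * Complex.exp (((t.im * p.2 : ℝ) : ℂ) * Complex.I) := by
    intro p
    rw [← Complex.exp_add, ← add_mul, ← Complex.ofReal_add]
    congr 3
    simp
    ring
  simp only [h]
  rw [integral_prod_mul (fun x : ℝ => Complex.exp (((t.re * x : ℝ) : ℂ) * Complex.I))
    (fun x : ℝ => Complex.exp (((t.im * x : ℝ) : ℂ) * Complex.I)),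
    gaussianReal_integral_exp, gaussianReal_integral_exp, ← Complex.exp_add,
    ← Complex.ofReal_add]
  congr 2
  rw [← Complex.normSq_eq_norm_sq, Complex.normSq_apply,
    Real.coe_toNNReal _ (by norm_num : (0 : ℝ) ≤ 1 / 2)]
  ring

lemma complexGaussian_scale (r : ℝ) :
    Measure.map (fun x : ℂ => x * (r : ℂ)) (complexGaussian 1) = complexGaussian (r ^ 2) := by
  unfold complexGaussian
  have h : (r ^ 2 / 2 : ℝ) = r ^ 2 * (1 / 2) := by ring
  rw [h, ← gaussianReal_scale, Measure.map_prod_map _ _ (by fun_prop) (by fun_prop),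
    Measure.map_map (by fun_prop) measurable_mkC, Measure.map_map measurable_mkC (by fun_prop)]
  congr 1
  funext p
  apply Complex.ext <;> simp

lemma complexGaussian_ac : complexGaussian 1 ≪ (volume : Measure ℂ) := by
  have hv : (1 / 2 : ℝ).toNNReal ≠ 0 := by
    simp
  have h1 := (gaussianReal_absolutelyContinuous 0 hv).prod
    (gaussianReal_absolutelyContinuous 0 hv)
  have h2 := h1.map measurable_mkC
  have h3 : Measure.map (fun p : ℝ × ℝ => (⟨p.1, p.2⟩ : ℂ))
      ((volume : Measure ℝ).prod (volume : Measure ℝ)) = volume :=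
    (Complex.volume_preserving_equiv_real_prod.symm).map_eq
  rw [h3] at h2
  exact h2

/-- conditionally on the eigenvalues of `(X^{An})^* X^{An}`, the transformed
Jacobi eigenvalues form a generalized Wishart ensemble, for β = 1 and β = 2. -/
theorem jacobi_conditionally_wishart
    (A n m : ℕ) (hm : 1 ≤ m) (hmn : m ≤ n) (hnA : n ≤ A) :
    (∀ (Ω : Type) (_ : MeasurableSpace Ω) (P : Measure Ω) (_ : IsProbabilityMeasure P)
      (X Y : ℕ → ℕ → Ω → ℝ), (∀ i j, Measurable (X i j)) → (∀ i j, Measurable (Y i j)) →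
      iIndepFun
        (Sum.elim (fun p : ℕ × ℕ => X p.1 p.2) (fun p : ℕ × ℕ => Y p.1 p.2)) P →
      (∀ i j, Measure.map (X i j) P = gaussianReal 0 1) →
      (∀ i j, Measure.map (Y i j) P = gaussianReal 0 1) →
      ∀ f : Arr m n → ℝ≥0∞, Measurable f → ∀ g : (Fin n → ℝ) → ℝ≥0∞, Measurable g →
        ∫⁻ ω, g (fun j => eigsDesc ((SxR A n fun i k => X i k ω).map Complex.ofReal) (j : ℕ)) *
            f (tauArrR A n m (fun i k => X i k ω) fun i k => Y i k ω) ∂P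
          = ∫⁻ ω, g (fun j => eigsDesc ((SxR A n fun i k => X i k ω).map Complex.ofReal) (j : ℕ)) *
              ∫⁻ a, f a ∂(wishartLawR n m
                fun j => eigsDesc ((SxR A n fun i k => X i k ω).map Complex.ofReal) (j : ℕ)) ∂P) ∧
    (∀ (Ω : Type) (_ : MeasurableSpace Ω) (P : Measure Ω) (_ : IsProbabilityMeasure P)
      (X Y : ℕ → ℕ → Ω → ℂ), (∀ i j, Measurable (X i j)) → (∀ i j, Measurable (Y i j)) →
      iIndepFun
        (Sum.elim (fun p : ℕ × ℕ => X p.1 p.2) (fun p : ℕ × ℕ => Y p.1 p.2)) P →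
      (∀ i j, Measure.map (X i j) P = complexGaussian 1) →
      (∀ i j, Measure.map (Y i j) P = complexGaussian 1) →
      ∀ f : Arr m n → ℝ≥0∞, Measurable f → ∀ g : (Fin n → ℝ) → ℝ≥0∞, Measurable g →
        ∫⁻ ω, g (fun j => eigsDesc (SxC A n fun i k => X i k ω) (j : ℕ)) *
            f (tauArrC A n m (fun i k => X i k ω) fun i k => Y i k ω) ∂P
          = ∫⁻ ω, g (fun j => eigsDesc (SxC A n fun i k => X i k ω) (j : ℕ)) *
              ∫⁻ a, f a ∂(wishartLawC n m
                fun j => eigsDesc (SxC A n fun i k => X i k ω) (j : ℕ)) ∂P) := by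
  refine ⟨?_, ?_⟩
  · intro Ω _ P _ X Y hX hY hind hXl hYl f hf g hg
    have key := generic_jacobi_wishart (𝕜 := ℝ) (fun v => gaussianReal 0 v.toNNReal)
      (fun v => inferInstance) (1 / 2)
      (fun t => by
        have h := gaussianReal_integral_exp 1 t
        simp only [Real.toNNReal_one]
        convert h using 4
        · simp [mul_comm]
        · simp
        · exact Real.norm_eq_abs t ▸ sq_abs t)
      (fun r _ => by simpa using gaussianReal_scale r 1)
      volume
      (by
        simp only [Real.toNNReal_one]
        exact gaussianReal_absolutelyContinuous 0 one_ne_zero)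
      Complex.ofRealHom Complex.continuous_ofReal (fun z => by simp) (fun r => rfl)
      (m := m) hnA P X Y hX hY hind
      (fun i j => by simp only [Real.toNNReal_one]; exact hXl i j)
      (fun i j => by simp only [Real.toNNReal_one]; exact hYl i j) f hf g hg
    simp only [SxR_map, tauArrR_eq, wishartLawR_eq]
    exact key
  · intro Ω _ P _ X Y hX hY hind hXl hYl f hf g hg
    exact generic_jacobi_wishart (𝕜 := ℂ) complexGaussian
      (fun v => inferInstance) (1 / 4) complexGaussian_integral
      (fun r _ => complexGaussian_scale r) volume complexGaussian_ac
      (RingHom.id ℂ) continuous_id (fun z => rfl) (fun r => rfl)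
      (m := m) hnA P X Y hX hY hind hXl hYl f hf g hg

end RMT
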